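/- Let G be a finitely presented group, let H be a subgroup of G which is isomorphic to a free group of finite rank and which satisfies CEP as a subgroup of G, and let R ⊆ H. Then the quotient G/⟪R⟫_G is finitely presented if and only if the quotient H/⟪R⟫_H is finitely presented. -/

import Mathlib

/-- A group is *finitely presented* if it is isomorphic to the quotient of a
finitely generated free group by the normal closure of a finite set of relators. -/
def FinitelyPresented (G : Type*) [Group G] : Prop :=
  ∃ (n : ℕ) (R : Set (FreeGroup (Fin n))), R.Finite ∧
    Nonempty ((FreeGroup (Fin n) ⧸ Subgroup.normalClosure R) ≃* G)

/-- A subgroup `H ≤ G` satisfies the *Congruence Extension Property* (CEP) if for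
every subset `R ⊆ H`, the normal closure of `R` in `H` equals `H ∩ ⟪R⟫_G`
(expressed as the pullback of the normal closure of `R` in `G` along `H ↪ G`). -/
def IsCEP {G : Type*} [Group G] (H : Subgroup G) : Prop :=
  ∀ R : Set H, Subgroup.normalClosure R =
    (Subgroup.normalClosure (Subtype.val '' R)).comap H.subtype

theorem finitelyPresented_iff_isFinitelyPresented {G : Type*} [Group G] :
    FinitelyPresented G ↔ Group.IsFinitelyPresented G := by
  constructor
  · rintro ⟨n, S, hS, ⟨e⟩⟩
    have : Group.IsFinitelyPresented (FreeGroup (Fin n) ⧸ Subgroup.normalClosure S) :=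
      .quotient _ ⟨S, hS, rfl⟩
    exact .equiv e
  · intro h
    obtain ⟨n, S, hS, ⟨e⟩⟩ := h.exists_mulEquiv_presentedGroup
    exact ⟨n, S, hS, ⟨e.symm⟩⟩

theorem Group.IsFinitelyPresented.group_fg {G : Type*} [Group G]
    (hG : Group.IsFinitelyPresented G) : Group.FG G := by
  obtain ⟨n, φ, hφ, -⟩ := hG.out
  exact Group.fg_of_surjective hφ

/-- The kernel of a surjection from a finitely generated group onto a finitely presented group
is the normal closure of a finite set. -/
theorem MonoidHom.ker_isFinitelyNormallyGenerated {G Q : Type*} [Group G] [Group Q]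
    [hG : Group.FG G] [hQ : Group.IsFinitelyPresented Q] (φ : G →* Q)
    (hφ : Function.Surjective φ) : φ.ker.IsFinitelyNormallyGenerated := by
  obtain ⟨n, ψ, hψ, S, hS, hSψ⟩ := hQ.out
  obtain ⟨X, hX, hXfin⟩ := Group.fg_iff.1 hG
  choose v hv using fun i => hφ (ψ (FreeGroup.of i))
  let θ : FreeGroup (Fin n) →* G := FreeGroup.lift v
  have hθ (w) : φ (θ w) = ψ w := by
    have : φ.comp θ = ψ := by
      ext i
      simp [θ, hv]
    exact DFunLike.congr_fun this w
  choose u hu using fun x => hψ (φ x)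
  let T : Set G := θ '' S ∪ (fun x => x * (θ (u x))⁻¹) '' X
  have hTker : Subgroup.normalClosure T ≤ φ.ker := by
    apply Subgroup.normalClosure_le_normal
    rintro _ (⟨s, hs, rfl⟩ | ⟨x, -, rfl⟩)
    · have : s ∈ ψ.ker := hSψ ▸ Subgroup.subset_normalClosure hs
      simpa [MonoidHom.mem_ker, hθ] using this
    · simp [MonoidHom.mem_ker, hθ, hu]
  refine ⟨T, (hS.image _).union (hXfin.image _), hTker.antisymm fun g hg => ?_⟩
  have htop : Subgroup.normalClosure T ⊔ θ.range = ⊤ := by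
    rw [eq_top_iff, ← hX, Subgroup.closure_le]
    intro x hx
    have h : x * (θ (u x))⁻¹ * θ (u x) ∈ Subgroup.normalClosure T ⊔ θ.range :=
      Subgroup.mul_mem_sup (Subgroup.subset_normalClosure (Or.inr ⟨x, hx, rfl⟩)) ⟨u x, rfl⟩
    simpa using h
  have hg' : g ∈ Subgroup.normalClosure T ⊔ θ.range := htop ▸ Subgroup.mem_top g
  obtain ⟨k, hk, _, ⟨w, rfl⟩, rfl⟩ := Subgroup.mem_sup_of_normal_left.1 hg'
  have hw : w ∈ Subgroup.normalClosure S := by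
    rw [hSψ, MonoidHom.mem_ker, ← hθ]
    have h := MonoidHom.mem_ker.1 hg
    rwa [map_mul, MonoidHom.mem_ker.1 (hTker hk), one_mul] at h
  refine mul_mem hk (Subgroup.normalClosure_mono Set.subset_union_left ?_)
  exact Subgroup.map_normalClosure_le S θ ⟨w, hw, rfl⟩

/-- A quotient of a finitely presented group by a normal subgroup is finitely presented iff
the normal subgroup is the normal closure of a finite set. -/
theorem Group.isFinitelyPresented_quotient_iff {G : Type*} [Group G]
    [hG : Group.IsFinitelyPresented G] (N : Subgroup G) [N.Normal] :
    Group.IsFinitelyPresented (G ⧸ N) ↔ N.IsFinitelyNormallyGenerated := by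
  refine ⟨fun h => ?_, fun h => .quotient N h⟩
  have := hG.group_fg
  simpa using (QuotientGroup.mk' N).ker_isFinitelyNormallyGenerated (QuotientGroup.mk'_surjective N)

theorem Subgroup.exists_finite_subset_mem_normalClosure {G : Type*} [Group G] {R : Set G} {x : G}
    (hx : x ∈ normalClosure R) : ∃ S ⊆ R, S.Finite ∧ x ∈ normalClosure S := by
  refine closure_induction (fun y hy => ?_) ⟨∅, by simp⟩ ?_ ?_ hx
  · obtain ⟨r, hr, hry⟩ := Group.mem_conjugatesOfSet_iff.1 hy
    exact ⟨{r}, by simpa using hr, Set.finite_singleton r,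
      conjugatesOfSet_subset_normalClosure (Group.mem_conjugatesOfSet_iff.2 ⟨r, rfl, hry⟩)⟩
  · rintro y z - - ⟨S, hSR, hS, hy⟩ ⟨T, hTR, hT, hz⟩
    exact ⟨S ∪ T, Set.union_subset hSR hTR, hS.union hT,
      mul_mem (normalClosure_mono Set.subset_union_left hy)
        (normalClosure_mono Set.subset_union_right hz)⟩
  · rintro y - ⟨S, hSR, hS, hy⟩
    exact ⟨S, hSR, hS, inv_mem hy⟩

theorem Subgroup.IsFinitelyNormallyGenerated.exists_finite_subset {G : Type*} [Group G] {R : Set G}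
    (h : (normalClosure R).IsFinitelyNormallyGenerated) :
    ∃ S ⊆ R, S.Finite ∧ normalClosure S = normalClosure R := by
  obtain ⟨T, hT, hTR⟩ := h
  choose S hSR hS hmem using fun t : T =>
    exists_finite_subset_mem_normalClosure (hTR ▸ subset_normalClosure t.2)
  have := hT.to_subtype
  have hsub : ⋃ t, S t ⊆ R := Set.iUnion_subset hSR
  refine ⟨⋃ t, S t, hsub, Set.finite_iUnion hS, (normalClosure_mono hsub).antisymm ?_⟩
  rw [← hTR]
  exact normalClosure_le_normal fun t ht =>
    normalClosure_mono (Set.subset_iUnion S ⟨t, ht⟩) (hmem ⟨t, ht⟩)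

theorem Subgroup.normalClosure_image_normalClosure {G K : Type*} [Group G] [Group K] (f : G →* K)
    (R : Set G) : normalClosure (f '' (normalClosure R : Set G)) = normalClosure (f '' R) :=
  le_antisymm (normalClosure_le_normal (map_normalClosure_le R f))
    (normalClosure_mono (Set.image_mono subset_normalClosure))

/-- If `G` is finitely presented, `H ≤ G` is a CEP subgroup which is free of finite
rank, and `R ⊆ H`, then `G/⟪R⟫_G` is finitely presented iff `H/⟪R⟫_H` is. -/
theorem stmt_12 {G : Type*} [Group G] (hG : FinitelyPresented G) (H : Subgroup G)
    (hCEP : IsCEP H) (hfree : ∃ n : ℕ, Nonempty (H ≃* FreeGroup (Fin n)))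
    (R : Set H) :
    FinitelyPresented (G ⧸ Subgroup.normalClosure (Subtype.val '' R)) ↔
      FinitelyPresented (H ⧸ Subgroup.normalClosure R) := by
  obtain ⟨n, ⟨e⟩⟩ := hfree
  have hGfp := finitelyPresented_iff_isFinitelyPresented.1 hG
  have hHfp : Group.IsFinitelyPresented H := .equiv e.symm
  rw [finitelyPresented_iff_isFinitelyPresented, finitelyPresented_iff_isFinitelyPresented,
    Group.isFinitelyPresented_quotient_iff, Group.isFinitelyPresented_quotient_iff]
  constructor
  · intro h
    obtain ⟨S, hSR, hS, hSeq⟩ := h.exists_finite_subset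
    obtain ⟨S, -, rfl⟩ := Set.subset_image_iff.1 hSR
    exact ⟨S, hS.of_finite_image Subtype.val_injective.injOn, by rw [hCEP S, hCEP R, hSeq]⟩
  · rintro ⟨S, hS, hSR⟩
    refine ⟨Subtype.val '' S, hS.image _, ?_⟩
    have hS' := Subgroup.normalClosure_image_normalClosure H.subtype S
    rw [hSR, Subgroup.normalClosure_image_normalClosure] at hS'
    exact hS'.symm
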